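/- Let A⁽¹⁾ : ℝ² → M₂(ℂ) be smooth, Λ_h-periodic, Hermitian-valued, with conj(A⁽¹⁾(−x)) = A⁽¹⁾(x) and A⁽¹⁾(Rᵀx) = Rᵀ A⁽¹⁾(x) R for all x ∈ ℝ². Let τ = e^{2πi/3} and σ ∈ {1, τ, conj(τ)}, and set Φ⁰_σ(x) = (1/√(3|Ω_h|)) [e^{iK·x} + conj(σ) e^{iRK·x} + σ e^{iR²K·x}]. Then ∫_{Ω_h} conj(Φ⁰_σ(x)) (L^{A⁽¹⁾} Φ⁰_σ)(x) dx = Kᵀ A⁽¹⁾_{(0,0)} K + (σ + conj(σ)) Kᵀ A⁽¹⁾_{(0,−1)} (RK). -/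

import Mathlib

open Matrix MeasureTheory Complex

noncomputable section

abbrev V2 : Type := Fin 2 → ℝ
abbrev M2 : Type := Matrix (Fin 2) (Fin 2) ℂ

/-- Partial derivative in coordinate direction `i`. -/
noncomputable def pd (i : Fin 2) (f : V2 → ℂ) (x : V2) : ℂ :=
  fderiv ℝ f x (Pi.single i 1)

/-- The divergence-form operator `L^A f = -∑ ∂_i (a_{ij} ∂_j f)`. -/
noncomputable def LA (A : V2 → M2) (f : V2 → ℂ) (x : V2) : ℂ :=
  -∑ i : Fin 2, ∑ j : Fin 2, pd i (fun y => A y i j * pd j f y) x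

/-- Lattice basis vector `v₁ = (√3/2, 1/2)`. -/
def v1 : V2 := ![Real.sqrt 3 / 2, 1 / 2]

/-- Lattice basis vector `v₂ = (√3/2, -1/2)`. -/
def v2 : V2 := ![Real.sqrt 3 / 2, -(1 / 2)]

/-- `Λ_h`-periodicity of a matrix-valued function. -/
def perM (A : V2 → M2) : Prop := ∀ x : V2, ∀ m n : ℤ, A (x + m • v1 + n • v2) = A x

/-- `k`-pseudoperiodicity: `f(x + v) = e^{i k·v} f(x)` for all lattice vectors `v`. -/
def pseudoPer (k : V2) (f : V2 → ℂ) : Prop :=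
  ∀ x : V2, ∀ m n : ℤ,
    f (x + m • v1 + n • v2) =
      Complex.exp (Complex.I * ((k ⬝ᵥ ((m • v1 + n • v2 : V2)) : ℝ) : ℂ)) * f x

/-- The fundamental cell `Ω_h = {t₁ v₁ + t₂ v₂ : 0 ≤ t₁, t₂ ≤ 1}`. -/
def Ωh : Set V2 :=
  {y | ∃ t1 t2 : ℝ, t1 ∈ Set.Icc (0:ℝ) 1 ∧ t2 ∈ Set.Icc (0:ℝ) 1 ∧ y = t1 • v1 + t2 • v2}

/-- Dual basis vector `k₁ = (2π/√3)(1, √3)`. -/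
def kv1 : V2 := ![2 * Real.pi / Real.sqrt 3, 2 * Real.pi]

/-- Dual basis vector `k₂ = (2π/√3)(1, -√3)`. -/
def kv2 : V2 := ![2 * Real.pi / Real.sqrt 3, -(2 * Real.pi)]

/-- Fourier coefficient `A_m = (1/|Ω_h|) ∫_{Ω_h} e^{-i(m₁k₁+m₂k₂)·y} A(y) dy`,
where `|Ω_h| = √3/2`. -/
noncomputable def Acoef (A : V2 → M2) (m : ℤ × ℤ) : M2 :=
  Matrix.of fun i j =>
    ((Real.sqrt 3 / 2 : ℝ) : ℂ)⁻¹ *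
      ∫ y in Ωh, Complex.exp (-Complex.I * (((m.1 • kv1 + m.2 • kv2 : V2) ⬝ᵥ y : ℝ) : ℂ)) * A y i j

/-- The 120° clockwise rotation matrix. -/
def Rmat : Matrix (Fin 2) (Fin 2) ℝ := !![-1/2, Real.sqrt 3/2; -Real.sqrt 3/2, -1/2]

/-- The vertex `K = (0, 4π/3)`. -/
def Kpt : V2 := ![0, 4 * Real.pi / 3]

/-- Complexification of a real matrix. -/
def cM (O : Matrix (Fin 2) (Fin 2) ℝ) : M2 := O.map (fun t => (t : ℂ))

/-- `τ = e^{2πi/3}`. -/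
noncomputable def τ : ℂ := Complex.exp (2 * Real.pi * Complex.I / 3)

/-- Invariance under translation by the lattice generators `v₁` and `v₂`. -/
def CellPeriodic (f : V2 → ℂ) : Prop := ∀ x, f (x + v1) = f x ∧ f (x + v2) = f x

/-- The linear parametrization `t ↦ t₀ v₁ + t₁ v₂` of the plane by lattice coordinates. -/
def cellMap : V2 →L[ℝ] V2 :=
  (ContinuousLinearMap.proj (R := ℝ) (φ := fun _ : Fin 2 => ℝ) 0).smulRight v1 +
    (ContinuousLinearMap.proj (R := ℝ) (φ := fun _ : Fin 2 => ℝ) 1).smulRight v2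

lemma cellMap_apply (t : V2) : cellMap t = t 0 • v1 + t 1 • v2 := by
  simp [cellMap]

lemma cellMap_det : cellMap.det = -(Real.sqrt 3 / 2) := by
  have h : (cellMap : V2 →ₗ[ℝ] V2) = Matrix.toLin' !![v1 0, v2 0; v1 1, v2 1] := by
    ext i j
    fin_cases i <;> fin_cases j <;> simp [cellMap, v1, v2]
  rw [ContinuousLinearMap.det, h, LinearMap.det_toLin', Matrix.det_fin_two_of]
  simp [v1, v2]
  ring

lemma cellMap_injective : Function.Injective cellMap := by
  intro s t h
  rw [cellMap_apply, cellMap_apply] at h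
  have h3 : Real.sqrt 3 ≠ 0 := by positivity
  have h0 := congrFun h 0
  have h1 := congrFun h 1
  simp [v1, v2] at h0 h1
  have e0 : s 0 + s 1 = t 0 + t 1 := by
    apply mul_right_cancel₀ h3
    linarith
  ext i
  fin_cases i
  · show s 0 = t 0
    linarith
  · show s 1 = t 1
    linarith

lemma cell_eq_image : Ωh = cellMap '' Set.Icc 0 1 := by
  ext y
  simp only [Ωh, Set.mem_ofPred_eq, Set.mem_image, cellMap_apply]
  constructor
  · rintro ⟨a, b, ha, hb, rfl⟩
    refine ⟨![a, b], ⟨fun i => ?_, fun i => ?_⟩, by simp⟩ <;> fin_cases i <;>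
      simp [ha.1, hb.1, ha.2, hb.2]
  · rintro ⟨t, ht, rfl⟩
    exact ⟨t 0, t 1, ⟨ht.1 0, ht.2 0⟩, ⟨ht.1 1, ht.2 1⟩, rfl⟩

lemma isCompact_cell : IsCompact Ωh := by
  rw [cell_eq_image]
  exact isCompact_Icc.image cellMap.continuous

lemma Continuous.integrableOn_cell {f : V2 → ℂ} (hf : Continuous f) : IntegrableOn f Ωh :=
  hf.continuousOn.integrableOn_compact isCompact_cell

lemma setIntegral_cell {f : V2 → ℂ} (hf : Continuous f) :
    ∫ x in Ωh, f x =
      ((Real.sqrt 3 / 2 : ℝ) : ℂ) * ∫ t in (0 : ℝ)..1, ∫ s in (0 : ℝ)..1, f (t • v1 + s • v2) := by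
  rw [cell_eq_image, integral_image_eq_integral_abs_det_fderiv_smul volume measurableSet_Icc
    (fun x _ => cellMap.hasFDerivAt.hasFDerivWithinAt) cellMap_injective.injOn]
  have hd : |cellMap.det| = Real.sqrt 3 / 2 := by
    rw [cellMap_det, abs_neg, abs_of_nonneg (by positivity)]
  simp only [hd]
  rw [integral_smul, Complex.real_smul]
  congr 1
  have hpre : (Set.Icc 0 1 : Set V2) =
      MeasurableEquiv.finTwoArrow ⁻¹' (Set.Icc (0 : ℝ) 1 ×ˢ Set.Icc (0 : ℝ) 1) := by
    ext t
    simp [MeasurableEquiv.finTwoArrow, Pi.le_def, Fin.forall_fin_two]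
  have hcomp : ∀ t : V2, f (cellMap t) =
      (fun p : ℝ × ℝ => f (p.1 • v1 + p.2 • v2)) (MeasurableEquiv.finTwoArrow t) := by
    intro t
    simp [cellMap_apply, MeasurableEquiv.finTwoArrow]
  simp only [hcomp]
  rw [hpre, (volume_preserving_finTwoArrow ℝ).setIntegral_preimage_emb
    MeasurableEquiv.finTwoArrow.measurableEmbedding
    (fun p : ℝ × ℝ => f (p.1 • v1 + p.2 • v2))]
  have hc : Continuous fun p : ℝ × ℝ => f (p.1 • v1 + p.2 • v2) := by fun_prop
  rw [Measure.volume_eq_prod, setIntegral_prod]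
  · simp only [intervalIntegral.integral_of_le zero_le_one, integral_Icc_eq_integral_Ioc]
  · exact hc.continuousOn.integrableOn_compact (isCompact_Icc.prod isCompact_Icc)


lemma intervalIntegral_periodic_comp_sub_left {g : ℝ → ℂ} (hg : Function.Periodic g 1) (d : ℝ) :
    ∫ t in (0 : ℝ)..1, g (d - t) = ∫ t in (0 : ℝ)..1, g t := by
  rw [intervalIntegral.integral_comp_sub_left]
  have h := hg.intervalIntegral_add_eq (d - 1) 0
  rwa [sub_add_cancel, zero_add, ← sub_zero d, sub_right_comm, sub_zero] at h

lemma CellPeriodic.periodic_left {f : V2 → ℂ} (hp : CellPeriodic f) (s : ℝ) :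
    Function.Periodic (fun t : ℝ => f (t • v1 + s • v2)) 1 := by
  intro t
  show f _ = f _
  rw [← (hp (t • v1 + s • v2)).1]
  congr 1
  module

lemma CellPeriodic.periodic_right {f : V2 → ℂ} (hp : CellPeriodic f) (t : ℝ) :
    Function.Periodic (fun s : ℝ => f (t • v1 + s • v2)) 1 := by
  intro s
  show f _ = f _
  rw [← (hp (t • v1 + s • v2)).2]
  congr 1
  module

lemma intervalIntegral_swap_of_continuous {F : ℝ → ℝ → ℂ} (hF : Continuous (Function.uncurry F)) :
    ∫ t in (0 : ℝ)..1, ∫ s in (0 : ℝ)..1, F t s = ∫ s in (0 : ℝ)..1, ∫ t in (0 : ℝ)..1, F t s := by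
  apply intervalIntegral_intervalIntegral_swap
  apply (hF.continuousOn.integrableOn_compact (isCompact_Icc.prod isCompact_Icc)).mono_set
  exact Set.prod_mono Set.uIoc_subset_uIcc Set.uIoc_subset_uIcc

lemma setIntegral_cell_comp_neg {f : V2 → ℂ} (hf : Continuous f) (hp : CellPeriodic f) :
    ∫ x in Ωh, f (-x) = ∫ x in Ωh, f x := by
  rw [setIntegral_cell (f := fun x => f (-x)) (hf.comp continuous_neg), setIntegral_cell hf]
  congr 1
  have hin : ∀ t : ℝ, ∫ s in (0 : ℝ)..1, f (-(t • v1 + s • v2)) =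
      ∫ s in (0 : ℝ)..1, f ((0 - t) • v1 + s • v2) := by
    intro t
    rw [← intervalIntegral_periodic_comp_sub_left (hp.periodic_right (0 - t)) 0]
    congr 1
    ext s
    congr 1
    module
  simp only [hin]
  apply intervalIntegral_periodic_comp_sub_left (g := fun t =>
    ∫ s in (0 : ℝ)..1, f (t • v1 + s • v2))
  intro t
  show intervalIntegral _ _ _ _ = intervalIntegral _ _ _ _
  congr 1
  ext s
  exact hp.periodic_left s t

lemma Rmat_transpose_mulVec_cell (t s : ℝ) :
    Rmatᵀ.mulVec (t • v1 + s • v2) = s • v1 + (-s - t) • v2 := by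
  have h3 : Real.sqrt 3 * Real.sqrt 3 = 3 := Real.mul_self_sqrt (by norm_num)
  ext i
  fin_cases i <;>
    simp [Rmat, Matrix.mulVec, dotProduct, Fin.sum_univ_two, v1, v2]
  · ring
  · linear_combination (t + s) / 4 * h3

lemma setIntegral_cell_comp_rotation {f : V2 → ℂ} (hf : Continuous f) (hp : CellPeriodic f) :
    ∫ x in Ωh, f (Rmatᵀ.mulVec x) = ∫ x in Ωh, f x := by
  have hR : Continuous fun x : V2 => Rmatᵀ.mulVec x := by fun_prop
  rw [setIntegral_cell (f := fun x => f (Rmatᵀ.mulVec x)) (hf.comp hR), setIntegral_cell hf]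
  simp only [Rmat_transpose_mulVec_cell]
  congr 1
  rw [intervalIntegral_swap_of_continuous (by
    simp only [Function.uncurry_def]
    fun_prop)]
  congr 1
  ext s
  exact intervalIntegral_periodic_comp_sub_left (hp.periodic_right s) (-s)

lemma setIntegral_cell_fderiv_right {f : V2 → ℂ} (hf : ContDiff ℝ 1 f) (hp : CellPeriodic f) :
    ∫ x in Ωh, fderiv ℝ f x v2 = 0 := by
  have hc : Continuous fun x => fderiv ℝ f x v2 :=
    (hf.continuous_fderiv one_ne_zero).clm_apply continuous_const
  rw [setIntegral_cell hc]
  have hin : ∀ t : ℝ, ∫ s in (0 : ℝ)..1, fderiv ℝ f (t • v1 + s • v2) v2 = 0 := by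
    intro t
    have hd : ∀ s : ℝ, HasDerivAt (fun s : ℝ => f (t • v1 + s • v2))
        (fderiv ℝ f (t • v1 + s • v2) v2) s := by
      intro s
      have h1 : HasDerivAt (fun s : ℝ => t • v1 + s • v2) v2 s := by
        simpa using ((hasDerivAt_id s).smul_const v2).const_add (t • v1)
      exact ((hf.differentiable one_ne_zero _).hasFDerivAt).comp_hasDerivAt s h1
    rw [intervalIntegral.integral_eq_sub_of_hasDerivAt (fun s _ => hd s)]
    · have := hp.periodic_right t 0
      simp only [zero_add] at this
      rw [this, sub_self]
    · exact (hc.comp (by fun_prop : Continuous fun s : ℝ => t • v1 + s • v2)).intervalIntegrable _ _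
  simp [hin]

lemma setIntegral_cell_fderiv_left {f : V2 → ℂ} (hf : ContDiff ℝ 1 f) (hp : CellPeriodic f) :
    ∫ x in Ωh, fderiv ℝ f x v1 = 0 := by
  have hc : Continuous fun x => fderiv ℝ f x v1 :=
    (hf.continuous_fderiv one_ne_zero).clm_apply continuous_const
  rw [setIntegral_cell hc, intervalIntegral_swap_of_continuous (by
    exact hc.comp (by fun_prop : Continuous fun p : ℝ × ℝ => p.1 • v1 + p.2 • v2))]
  have hin : ∀ s : ℝ, ∫ t in (0 : ℝ)..1, fderiv ℝ f (t • v1 + s • v2) v1 = 0 := by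
    intro s
    have hd : ∀ t : ℝ, HasDerivAt (fun t : ℝ => f (t • v1 + s • v2))
        (fderiv ℝ f (t • v1 + s • v2) v1) t := by
      intro t
      have h1 : HasDerivAt (fun t : ℝ => t • v1 + s • v2) v1 t := by
        simpa using ((hasDerivAt_id t).smul_const v1).add_const (s • v2)
      exact ((hf.differentiable one_ne_zero _).hasFDerivAt).comp_hasDerivAt t h1
    rw [intervalIntegral.integral_eq_sub_of_hasDerivAt (fun t _ => hd t)]
    · have := hp.periodic_left s 0
      simp only [zero_add] at this
      rw [this, sub_self]
    · exact (hc.comp (by fun_prop : Continuous fun t : ℝ => t • v1 + s • v2)).intervalIntegrable _ _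
  simp [hin]

lemma exists_single_eq_cell_combination (i : Fin 2) :
    ∃ a b : ℝ, (Pi.single i 1 : V2) = a • v1 + b • v2 := by
  have h3 : Real.sqrt 3 ≠ 0 := by positivity
  fin_cases i
  · refine ⟨1 / Real.sqrt 3, 1 / Real.sqrt 3, ?_⟩
    ext j
    fin_cases j <;> simp [v1, v2]
    field_simp
    norm_num
  · refine ⟨1, -1, ?_⟩
    ext j
    fin_cases j <;> simp [v1, v2]
    norm_num

lemma setIntegral_cell_pd {f : V2 → ℂ} (hf : ContDiff ℝ 1 f) (hp : CellPeriodic f) (i : Fin 2) :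
    ∫ x in Ωh, pd i f x = 0 := by
  obtain ⟨a, b, hab⟩ := exists_single_eq_cell_combination i
  have hc : ∀ v : V2, Continuous fun x => fderiv ℝ f x v := fun v =>
    (hf.continuous_fderiv one_ne_zero).clm_apply continuous_const
  simp only [pd, hab, map_add, map_smul]
  rw [integral_add (f := fun x => a • fderiv ℝ f x v1) (g := fun x => b • fderiv ℝ f x v2)
    ((hc v1).const_smul a).integrableOn_cell ((hc v2).const_smul b).integrableOn_cell,
    integral_smul, integral_smul, setIntegral_cell_fderiv_left hf hp,
    setIntegral_cell_fderiv_right hf hp]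
  simp

/-- The plane wave `x ↦ e^{i k·x}`. -/
def planeWave (k x : V2) : ℂ := Complex.exp (Complex.I * ((k ⬝ᵥ x : ℝ) : ℂ))

lemma planeWave_add_left (k l x : V2) :
    planeWave (k + l) x = planeWave k x * planeWave l x := by
  simp only [planeWave, ← Complex.exp_add, add_dotProduct]
  push_cast
  ring_nf

lemma planeWave_add_right (k x y : V2) :
    planeWave k (x + y) = planeWave k x * planeWave k y := by
  simp only [planeWave, ← Complex.exp_add, dotProduct_add]
  push_cast
  ring_nf

lemma planeWave_neg (k x : V2) : planeWave (-k) x = planeWave k (-x) := by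
  simp only [planeWave, dotProduct_neg, neg_dotProduct]

lemma conj_planeWave (k x : V2) : starRingEnd ℂ (planeWave k x) = planeWave (-k) x := by
  simp only [planeWave, ← Complex.exp_conj, map_mul, Complex.conj_I, Complex.conj_ofReal,
    neg_dotProduct, Complex.ofReal_neg, neg_mul, mul_neg]

lemma hasFDerivAt_phase (k x : V2) :
    HasFDerivAt (fun y : V2 => Complex.I * ((k ⬝ᵥ y : ℝ) : ℂ)) (Complex.I •
      (Complex.ofRealCLM.comp (LinearMap.toContinuousLinearMap (dotProductBilin ℝ ℝ k)))) x :=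
  ((Complex.ofRealCLM.comp
    (LinearMap.toContinuousLinearMap (dotProductBilin ℝ ℝ k))).hasFDerivAt).const_mul Complex.I

lemma contDiff_planeWave (k : V2) : ContDiff ℝ (⊤ : ℕ∞) (planeWave k) :=
  (contDiff_const.mul (Complex.ofRealCLM.comp
    (LinearMap.toContinuousLinearMap (dotProductBilin ℝ ℝ k))).contDiff).cexp

lemma pd_planeWave (i : Fin 2) (k x : V2) :
    pd i (planeWave k) x = Complex.I * (k i : ℂ) * planeWave k x := by
  have h : fderiv ℝ (planeWave k) x = _ := (hasFDerivAt_phase k x).cexp.fderiv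
  rw [pd, h]
  simp [planeWave]
  ring

lemma pd_mul {f g : V2 → ℂ} {x : V2} (i : Fin 2) (hf : DifferentiableAt ℝ f x)
    (hg : DifferentiableAt ℝ g x) :
    pd i (fun y => f y * g y) x = f x * pd i g x + pd i f x * g x := by
  simp only [pd]
  rw [fderiv_fun_mul hf hg]
  simp
  ring

lemma cellPeriodic_planeWave (m n : ℤ) : CellPeriodic (planeWave (m • kv1 + n • kv2)) := by
  have h3 : Real.sqrt 3 ≠ 0 := by positivity
  have h1 : (m • kv1 + n • kv2) ⬝ᵥ v1 = m * (2 * Real.pi) := by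
    simp [kv1, kv2, v1, dotProduct, Fin.sum_univ_two]
    field_simp
    ring
  have h2 : (m • kv1 + n • kv2) ⬝ᵥ v2 = n * (2 * Real.pi) := by
    simp [kv1, kv2, v2, dotProduct, Fin.sum_univ_two]
    field_simp
    ring
  have he : ∀ l : ℤ, Complex.exp (Complex.I * ((l * (2 * Real.pi) : ℝ) : ℂ)) = 1 := fun l => by
    rw [← Complex.exp_int_mul_two_pi_mul_I l]
    push_cast
    ring_nf
  intro x
  rw [planeWave_add_right, planeWave_add_right]
  simp only [planeWave, h1, h2, he, mul_one, and_self]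

/-- The bilinear pairing `aᵀ M b` of real vectors through a complex matrix. -/
def matPair (M : M2) (a b : V2) : ℂ := ∑ i : Fin 2, ∑ j : Fin 2, (a i : ℂ) * M i j * (b j : ℂ)

lemma matPair_transpose (M : M2) (a b : V2) : matPair Mᵀ a b = matPair M b a := by
  simp [matPair, Fin.sum_univ_two]
  ring

lemma matPair_conj_mul (M : M2) (O : Matrix (Fin 2) (Fin 2) ℝ) (a b : V2) :
    matPair ((cM O)ᵀ * M * cM O) a b = matPair M (O.mulVec a) (O.mulVec b) := by
  simp [matPair, cM, Matrix.mul_apply, Matrix.mulVec, dotProduct, Fin.sum_univ_two]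
  ring

/-- The density `e^{-i(a-b)·x} aᵀ A(x) b` of the form `⟨e^{ia·x}, L^A e^{ib·x}⟩` after integration
by parts. -/
def waveDensity (A : V2 → M2) (a b x : V2) : ℂ := planeWave (b - a) x * matPair (A x) a b

section

variable {A : V2 → M2}

lemma continuous_waveDensity (hA : ∀ i j, Continuous fun x => A x i j) (a b : V2) :
    Continuous (waveDensity A a b) := by
  have := (contDiff_planeWave (b - a)).continuous
  unfold waveDensity matPair
  fun_prop

lemma perM.cellPeriodic (hper : perM A) (i j : Fin 2) : CellPeriodic fun x => A x i j := by
  intro x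
  have h1 := hper x 1 0
  have h2 := hper x 0 1
  simp only [one_zsmul, zero_zsmul, add_zero] at h1 h2
  exact ⟨by simp only [h1], by simp only [h2]⟩

lemma cellPeriodic_waveDensity (hper : perM A) {a b : V2}
    (hab : CellPeriodic (planeWave (b - a))) : CellPeriodic (waveDensity A a b) := by
  intro x
  simp only [waveDensity, matPair, (hab x).1, (hab x).2, fun i j => (hper.cellPeriodic i j x).1,
    fun i j => (hper.cellPeriodic i j x).2, and_self]

lemma setIntegral_waveDensity_rotation (hA : ∀ i j, Continuous fun x => A x i j) (hper : perM A)
    (hrot : ∀ x : V2, A (Rmatᵀ.mulVec x) = (cM Rmat)ᵀ * A x * cM Rmat) {a b : V2}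
    (hab : CellPeriodic (planeWave (b - a))) :
    ∫ x in Ωh, waveDensity A (Rmat.mulVec a) (Rmat.mulVec b) x =
      ∫ x in Ωh, waveDensity A a b x := by
  rw [← setIntegral_cell_comp_rotation (continuous_waveDensity hA a b)
    (cellPeriodic_waveDensity hper hab)]
  congr 1
  ext x
  rw [waveDensity, waveDensity, hrot, matPair_conj_mul, ← Matrix.mulVec_sub, planeWave, planeWave,
    Matrix.mulVec_transpose, dotProduct_comm, Matrix.dotProduct_mulVec, dotProduct_comm]

lemma setIntegral_waveDensity_swap (hA : ∀ i j, Continuous fun x => A x i j) (hper : perM A)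
    (hherm : ∀ x : V2, (A x).IsHermitian) (hpc : ∀ x : V2, (A (-x)).map (starRingEnd ℂ) = A x)
    {a b : V2} (hab : CellPeriodic (planeWave (b - a))) :
    ∫ x in Ωh, waveDensity A b a x = ∫ x in Ωh, waveDensity A a b x := by
  rw [← setIntegral_cell_comp_neg (continuous_waveDensity hA a b)
    (cellPeriodic_waveDensity hper hab)]
  congr 1
  ext x
  have hneg : A (-x) = (A x)ᵀ := by
    rw [← hpc (-x), neg_neg]
    conv_rhs => rw [← hherm x]
    rfl
  rw [waveDensity, waveDensity, ← neg_sub b a, planeWave_neg, hneg, matPair_transpose]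

lemma LA_planeWave (hsm : ∀ i j, ContDiff ℝ (⊤ : ℕ∞) fun x => A x i j) (a b x : V2) :
    planeWave (-a) x * LA A (planeWave b) x = waveDensity A a b x - ∑ i : Fin 2, ∑ j : Fin 2,
      pd i (fun y => planeWave (-a) y * (A y i j * pd j (planeWave b) y)) x := by
  have hd : ∀ i j, DifferentiableAt ℝ (fun y => A y i j * pd j (planeWave b) y) x := by
    intro i j
    simp only [pd_planeWave]
    exact ((hsm i j).differentiable (by simp) x).mul
      (((contDiff_planeWave b).differentiable (by simp) x).const_mul _)
  have hm := fun i j => pd_mul i ((contDiff_planeWave (-a)).differentiable (by simp) x) (hd i j)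
  have hE : planeWave (b - a) x = planeWave (-a) x * planeWave b x := by
    rw [← planeWave_add_left, neg_add_eq_sub]
  simp only [hm]
  simp only [LA, waveDensity, matPair, Fin.sum_univ_two, hE]
  simp only [pd_planeWave _ (-a) x, pd_planeWave _ b x, Pi.neg_apply, Complex.ofReal_neg]
  linear_combination (-(planeWave (-a) x * planeWave b x) * ((a 0 : ℂ) * A x 0 0 * b 0 +
    (a 0 : ℂ) * A x 0 1 * b 1 + (a 1 : ℂ) * A x 1 0 * b 0 + (a 1 : ℂ) * A x 1 1 * b 1)) *
      Complex.I_mul_I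

lemma contDiff_mul_pd_planeWave (hsm : ∀ i j, ContDiff ℝ (⊤ : ℕ∞) fun x => A x i j) (b : V2)
    (i j : Fin 2) : ContDiff ℝ 1 fun y => A y i j * pd j (planeWave b) y := by
  simp only [pd_planeWave]
  exact ((hsm i j).mul (contDiff_const.mul (contDiff_planeWave b))).of_le (by simp)

lemma continuous_LA_planeWave (hsm : ∀ i j, ContDiff ℝ (⊤ : ℕ∞) fun x => A x i j) (b : V2) :
    Continuous (LA A (planeWave b)) :=
  (continuous_finsetSum _ fun i _ => continuous_finsetSum _ fun j _ =>
    ((contDiff_mul_pd_planeWave hsm b i j).continuous_fderiv one_ne_zero).clm_apply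
      continuous_const).neg

lemma LA_sum_planeWave (hsm : ∀ i j, ContDiff ℝ (⊤ : ℕ∞) fun x => A x i j) {ι : Type*} [Fintype ι]
    (c : ι → ℂ) (k : ι → V2) (x : V2) :
    LA A (fun y => ∑ l, c l * planeWave (k l) y) x = ∑ l, c l * LA A (planeWave (k l)) x := by
  have hpd : ∀ j y, pd j (fun y => ∑ l, c l * planeWave (k l) y) y =
      ∑ l, c l * pd j (planeWave (k l)) y := by
    intro j y
    have hw := fun l => (contDiff_planeWave (k l)).differentiable (by simp) y
    simp only [pd]
    rw [fderiv_fun_sum fun l _ => (hw l).const_mul (c l)]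
    simp [fderiv_const_mul (hw _)]
  have hsum : ∀ i j, pd i (fun y => A y i j * pd j (fun y => ∑ l, c l * planeWave (k l) y) y) x =
      ∑ l, c l * pd i (fun y => A y i j * pd j (planeWave (k l)) y) x := by
    intro i j
    have hd := fun l => (contDiff_mul_pd_planeWave hsm (k l) i j).differentiable one_ne_zero x
    have he : (fun y => A y i j * pd j (fun y => ∑ l, c l * planeWave (k l) y) y) =
        fun y => ∑ l, c l * (A y i j * pd j (planeWave (k l)) y) := by
      ext y
      rw [hpd, Finset.mul_sum]
      exact Finset.sum_congr rfl fun l _ => by ring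
    rw [he, pd, fderiv_fun_sum fun l _ => (hd l).const_mul (c l)]
    simp only [fderiv_const_mul (hd _), _root_.sum_apply,
      _root_.smul_apply, smul_eq_mul]
    rfl
  simp only [LA, hsum, Fin.sum_univ_two, ← Finset.sum_add_distrib, ← Finset.sum_neg_distrib]
  exact Finset.sum_congr rfl fun l _ => by ring

lemma setIntegral_planeWave_LA (hsm : ∀ i j, ContDiff ℝ (⊤ : ℕ∞) fun x => A x i j)
    (hper : perM A) {a b : V2} (hab : CellPeriodic (planeWave (b - a))) :
    ∫ x in Ωh, planeWave (-a) x * LA A (planeWave b) x = ∫ x in Ωh, waveDensity A a b x := by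
  have hg : ∀ i j, ContDiff ℝ 1
      fun y => planeWave (-a) y * (A y i j * pd j (planeWave b) y) := by
    intro i j
    exact ((contDiff_planeWave (-a)).of_le (by simp)).mul (contDiff_mul_pd_planeWave hsm b i j)
  have hp : ∀ i j, CellPeriodic
      fun y => planeWave (-a) y * (A y i j * pd j (planeWave b) y) := by
    intro i j
    have he : (fun y => planeWave (-a) y * (A y i j * pd j (planeWave b) y)) =
        fun y => Complex.I * b j * A y i j * planeWave (b - a) y := by
      ext y
      rw [pd_planeWave, ← neg_add_eq_sub, planeWave_add_left]
      ring
    rw [he]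
    intro x
    simp only [(hab x).1, (hab x).2, (hper.cellPeriodic i j x).1, (hper.cellPeriodic i j x).2,
      and_self]
  have hc : ∀ i j, IntegrableOn
      (pd i fun y => planeWave (-a) y * (A y i j * pd j (planeWave b) y)) Ωh := fun i j =>
    (((hg i j).continuous_fderiv one_ne_zero).clm_apply continuous_const).integrableOn_cell
  simp only [LA_planeWave hsm]
  rw [integral_sub (continuous_waveDensity (fun i j => (hsm i j).continuous) a b).integrableOn_cell
    (integrable_finsetSum _ fun i _ => integrable_finsetSum _ fun j _ => hc i j),
    integral_finsetSum _ fun i _ => integrable_finsetSum _ fun j _ => hc i j]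
  simp only [fun i => integral_finsetSum Finset.univ fun j _ => hc i j,
    fun i j => setIntegral_cell_pd (hg i j) (hp i j) i]
  simp

lemma setIntegral_conj_mul_LA_sum (hsm : ∀ i j, ContDiff ℝ (⊤ : ℕ∞) fun x => A x i j)
    (hper : perM A) {ι : Type*} [Fintype ι] (c : ι → ℂ) (k : ι → V2)
    (hk : ∀ l n, CellPeriodic (planeWave (k n - k l))) :
    ∫ x in Ωh, starRingEnd ℂ (∑ l, c l * planeWave (k l) x) *
        LA A (fun y => ∑ l, c l * planeWave (k l) y) x =
      ∑ l, ∑ n, starRingEnd ℂ (c l) * c n * ∫ x in Ωh, waveDensity A (k l) (k n) x := by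
  have hc : ∀ l n, IntegrableOn (fun x => starRingEnd ℂ (c l) * c n *
      (planeWave (-k l) x * LA A (planeWave (k n)) x)) Ωh := fun l n =>
    (continuous_const.mul ((contDiff_planeWave (-k l)).continuous.mul
      (continuous_LA_planeWave hsm (k n)))).integrableOn_cell
  have he : ∀ x, starRingEnd ℂ (∑ l, c l * planeWave (k l) x) *
      LA A (fun y => ∑ l, c l * planeWave (k l) y) x =
      ∑ l, ∑ n, starRingEnd ℂ (c l) * c n *
        (planeWave (-k l) x * LA A (planeWave (k n)) x) := by
    intro x
    rw [LA_sum_planeWave hsm, map_sum, Finset.sum_mul_sum]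
    refine Finset.sum_congr rfl fun l _ => Finset.sum_congr rfl fun n _ => ?_
    rw [map_mul, conj_planeWave]
    ring
  simp only [he]
  rw [integral_finsetSum _ fun l _ => integrable_finsetSum _ fun n _ => hc l n]
  refine Finset.sum_congr rfl fun l _ => ?_
  rw [integral_finsetSum _ fun n _ => hc l n]
  refine Finset.sum_congr rfl fun n _ => ?_
  rw [integral_const_mul, setIntegral_planeWave_LA hsm hper (hk l n)]

lemma setIntegral_waveDensity_eq_Acoef (hA : ∀ i j, Continuous fun x => A x i j) (m : ℤ × ℤ)
    {a b : V2} (hm : a - b = m.1 • kv1 + m.2 • kv2) :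
    ∫ x in Ωh, waveDensity A a b x =
      ((Real.sqrt 3 / 2 : ℝ) : ℂ) * matPair (Acoef A m) a b := by
  have hne : ((Real.sqrt 3 / 2 : ℝ) : ℂ) ≠ 0 := Complex.ofReal_ne_zero.mpr (by positivity)
  have hE : ∀ x, Complex.exp (-Complex.I * (((m.1 • kv1 + m.2 • kv2 : V2) ⬝ᵥ x : ℝ) : ℂ)) =
      planeWave (b - a) x := by
    intro x
    rw [← hm, ← neg_sub b a, planeWave, neg_dotProduct]
    push_cast
    ring_nf
  have hc : ∀ i j, IntegrableOn
      (fun x => (a i : ℂ) * b j * (planeWave (b - a) x * A x i j)) Ωh := fun i j =>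
    (continuous_const.mul ((contDiff_planeWave (b - a)).continuous.mul (hA i j))).integrableOn_cell
  have he : ∀ x, waveDensity A a b x =
      ∑ i, ∑ j, (a i : ℂ) * b j * (planeWave (b - a) x * A x i j) := by
    intro x
    simp only [waveDensity, matPair, Finset.mul_sum]
    refine Finset.sum_congr rfl fun i _ => Finset.sum_congr rfl fun j _ => by ring
  simp only [he, matPair, Acoef, hE, Matrix.of_apply, Finset.mul_sum]
  rw [integral_finsetSum _ fun i _ => integrable_finsetSum _ fun j _ => hc i j]
  refine Finset.sum_congr rfl fun i _ => ?_
  rw [integral_finsetSum _ fun j _ => hc i j]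
  refine Finset.sum_congr rfl fun j _ => ?_
  rw [integral_const_mul]
  field_simp

end

lemma Rmat_mulVec_Kpt : Rmat.mulVec Kpt = Kpt + kv2 := by
  have h3 : Real.sqrt 3 * Real.sqrt 3 = 3 := Real.mul_self_sqrt (by norm_num)
  ext i
  fin_cases i
  · simp [Rmat, Kpt, kv2, Matrix.mulVec, dotProduct, Fin.sum_univ_two]
    field_simp
    linear_combination 4 * h3
  · simp [Rmat, Kpt, kv2, Matrix.mulVec, dotProduct, Fin.sum_univ_two]
    ring

lemma Rmat_sq_mulVec_Kpt : (Rmat * Rmat).mulVec Kpt = Kpt - kv1 := by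
  have h3 : Real.sqrt 3 * Real.sqrt 3 = 3 := Real.mul_self_sqrt (by norm_num)
  ext i
  fin_cases i
  · simp [Rmat, Kpt, kv1, Matrix.mulVec, dotProduct, Matrix.mul_apply, Fin.sum_univ_two]
    field_simp
    linear_combination -8 * h3
  · simp [Rmat, Kpt, kv1, Matrix.mulVec, dotProduct, Matrix.mul_apply, Fin.sum_univ_two]
    linear_combination (-Real.pi / 3) * h3

lemma Rmat_cube : Rmat * (Rmat * Rmat) = 1 := by
  have h3 : Real.sqrt 3 * Real.sqrt 3 = 3 := Real.mul_self_sqrt (by norm_num)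
  ext i j
  fin_cases i <;> fin_cases j <;> simp [Rmat, Matrix.mul_apply, Fin.sum_univ_two]
  · linear_combination (3 / 8) * h3
  · linear_combination (-Real.sqrt 3 / 8) * h3
  · linear_combination (Real.sqrt 3 / 8) * h3
  · linear_combination (3 / 8) * h3

lemma τ_cube : τ ^ 3 = 1 := by
  rw [τ, ← Complex.exp_nat_mul, ← Complex.exp_two_pi_mul_I]
  push_cast
  ring_nf

lemma τ_mul_conj : τ * starRingEnd ℂ τ = 1 := by
  have h : starRingEnd ℂ (2 * Real.pi * Complex.I / 3) = -(2 * Real.pi * Complex.I / 3) := by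
    simp only [map_div₀, map_mul, Complex.conj_ofReal, Complex.conj_I, map_ofNat]
    ring
  rw [τ, ← Complex.exp_conj, h, ← Complex.exp_add, add_neg_cancel, Complex.exp_zero]

/-- For a honeycomb structured medium `A⁽¹⁾` and
`Φ⁰_σ = (1/√(3|Ω_h|)) [e^{iK·x} + conj σ e^{iRK·x} + σ e^{iR²K·x}]`,
`⟨Φ⁰_σ, L^{A⁽¹⁾} Φ⁰_σ⟩ = Kᵀ A_{(0,0)} K + (σ + conj σ) Kᵀ A_{(0,-1)} (RK)`. -/
theorem quadratic_form_on_rotation_eigenmodes (A : V2 → M2)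
    (hsm : ∀ i j, ContDiff ℝ (⊤ : ℕ∞) fun x => A x i j)
    (hper : perM A)
    (hherm : ∀ x : V2, (A x).IsHermitian)
    (hpc : ∀ x : V2, (A (-x)).map (starRingEnd ℂ) = A x)
    (hrot : ∀ x : V2, A (Rmatᵀ.mulVec x) = (cM Rmat)ᵀ * A x * cM Rmat)
    (σ : ℂ) (hσ : σ = 1 ∨ σ = τ ∨ σ = starRingEnd ℂ τ)
    (Φ : V2 → ℂ)
    (hΦ : Φ = fun x =>
      ((1 / Real.sqrt (3 * (Real.sqrt 3 / 2)) : ℝ) : ℂ) *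
        (Complex.exp (Complex.I * ((Kpt ⬝ᵥ x : ℝ) : ℂ)) +
          starRingEnd ℂ σ * Complex.exp (Complex.I * ((Rmat.mulVec Kpt ⬝ᵥ x : ℝ) : ℂ)) +
          σ * Complex.exp (Complex.I * (((Rmat * Rmat).mulVec Kpt ⬝ᵥ x : ℝ) : ℂ)))) :
    (∫ x in Ωh, starRingEnd ℂ (Φ x) * LA A Φ x) =
      (∑ i : Fin 2, ∑ j : Fin 2, ((Kpt i : ℝ) : ℂ) * Acoef A (0, 0) i j * ((Kpt j : ℝ) : ℂ)) +
        (σ + starRingEnd ℂ σ) *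
          ∑ i : Fin 2, ∑ j : Fin 2,
            ((Kpt i : ℝ) : ℂ) * Acoef A (0, -1) i j * ((Rmat.mulVec Kpt j : ℝ) : ℂ) := by
  have hA : ∀ i j, Continuous fun x => A x i j := fun i j => (hsm i j).continuous
  have hσ1 : σ * starRingEnd ℂ σ = 1 := by
    rcases hσ with rfl | rfl | rfl
    · simp
    · exact τ_mul_conj
    · rw [Complex.conj_conj, mul_comm, τ_mul_conj]
  have hσ3 : σ ^ 3 = 1 := by
    rcases hσ with rfl | rfl | rfl
    · simp
    · exact τ_cube
    · rw [← map_pow, τ_cube, map_one]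
  have hσ2 : σ * σ = starRingEnd ℂ σ := by
    linear_combination (starRingEnd ℂ σ) * hσ3 - σ ^ 2 * hσ1
  have hσ2' : starRingEnd ℂ σ * starRingEnd ℂ σ = σ := by
    rw [← map_mul, hσ2, Complex.conj_conj]
  set N : ℝ := 1 / Real.sqrt (3 * (Real.sqrt 3 / 2)) with hN
  have hNN : (N : ℂ) * N * ((Real.sqrt 3 / 2 : ℝ) : ℂ) = 1 / 3 := by
    have hs : Real.sqrt (3 * (Real.sqrt 3 / 2)) ^ 2 = 3 * (Real.sqrt 3 / 2) :=
      Real.sq_sqrt (by positivity)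
    have hr : N * N * (Real.sqrt 3 / 2) = 1 / 3 := by
      rw [hN, ← sq, div_pow, hs]
      field_simp
    rw [← Complex.ofReal_mul, ← Complex.ofReal_mul, hr]
    simp
  let c : Fin 3 → ℂ := ![N, N * starRingEnd ℂ σ, N * σ]
  let k : Fin 3 → V2 := ![Kpt, Rmat.mulVec Kpt, (Rmat * Rmat).mulVec Kpt]
  have hΦk : Φ = fun x => ∑ l, c l * planeWave (k l) x := by
    rw [hΦ]
    ext x
    simp only [Fin.sum_univ_three, c, k, planeWave, Matrix.cons_val]
    ring
  obtain ⟨p, hp⟩ : ∃ p : Fin 3 → ℤ × ℤ, ∀ l, k l = Kpt + ((p l).1 • kv1 + (p l).2 • kv2) := by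
    refine ⟨![(0, 0), (0, 1), (-1, 0)], fun l => ?_⟩
    fin_cases l
    · simp [k]
    · simp only [k, Rmat_mulVec_Kpt]
      simp
    · simp only [k, Rmat_sq_mulVec_Kpt]
      simp [sub_eq_add_neg]
  have hk : ∀ l n, CellPeriodic (planeWave (k n - k l)) := by
    intro l n
    have := cellPeriodic_planeWave ((p n).1 - (p l).1) ((p n).2 - (p l).2)
    convert this using 2
    rw [hp, hp]
    module
  have hR : ∀ l, Rmat.mulVec (k l) = k (l + 1) := by
    intro l
    fin_cases l
    · rfl
    · exact Matrix.mulVec_mulVec Kpt Rmat Rmat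
    · show Rmat.mulVec ((Rmat * Rmat).mulVec Kpt) = Kpt
      rw [Matrix.mulVec_mulVec, Rmat_cube, Matrix.one_mulVec]
  have hrotk : ∀ l n, ∫ x in Ωh, waveDensity A (k (l + 1)) (k (n + 1)) x =
      ∫ x in Ωh, waveDensity A (k l) (k n) x := by
    intro l n
    rw [← hR, ← hR]
    exact setIntegral_waveDensity_rotation hA hper hrot (hk l n)
  have hdiag : ∫ x in Ωh, waveDensity A (k 0) (k 0) x =
      ((Real.sqrt 3 / 2 : ℝ) : ℂ) * matPair (Acoef A (0, 0)) Kpt Kpt :=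
    setIntegral_waveDensity_eq_Acoef hA (0, 0) (by simp [k])
  have hoff : ∫ x in Ωh, waveDensity A (k 0) (k 1) x =
      ((Real.sqrt 3 / 2 : ℝ) : ℂ) * matPair (Acoef A (0, -1)) Kpt (Rmat.mulVec Kpt) :=
    setIntegral_waveDensity_eq_Acoef hA (0, -1) (by
      show Kpt - Rmat.mulVec Kpt = _
      rw [Rmat_mulVec_Kpt]
      simp)
  have hswap : ∫ x in Ωh, waveDensity A (k 1) (k 0) x = ∫ x in Ωh, waveDensity A (k 0) (k 1) x :=
    setIntegral_waveDensity_swap hA hper hherm hpc (hk 0 1)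
  have h11 := hrotk 0 0
  have h22 := hrotk 1 1
  have h12 := hrotk 0 1
  have h20 := hrotk 1 2
  have h21 := hrotk 1 0
  have h02 := hrotk 2 1
  simp only [Fin.isValue, Fin.reduceAdd, zero_add] at h11 h22 h12 h20 h21 h02
  rw [hΦk, setIntegral_conj_mul_LA_sum hsm hper c k hk]
  simp only [Fin.sum_univ_three, h02, h20, h21, h22, h11, h12, hswap, hdiag, hoff]
  simp only [c, Matrix.cons_val, map_mul, Complex.conj_ofReal, Complex.conj_conj]
  change _ = matPair (Acoef A (0, 0)) Kpt Kpt +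
    (σ + starRingEnd ℂ σ) * matPair (Acoef A (0, -1)) Kpt (Rmat.mulVec Kpt)
  generalize matPair (Acoef A (0, 0)) Kpt Kpt = D
  generalize matPair (Acoef A (0, -1)) Kpt (Rmat.mulVec Kpt) = T
  generalize ((Real.sqrt 3 / 2 : ℝ) : ℂ) = S at *
  generalize starRingEnd ℂ σ = σ' at *
  linear_combination (3 * D + 3 * (σ + σ') * T) * hNN + 2 * N * N * S * D * hσ1 +
    N * N * S * T * (hσ2 + hσ2')
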